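/- Let p be a prime with p ≥ 5 and k a positive integer. Then the monomial X^k is planar over the finite field with p^4 elements if and only if there exists j ∈ {0, 1, 2, 3} such that k ≡ 2p^j (mod p^4 − 1). -/

import Mathlib

lemma pm_exists_ring_aux (p : ℕ) [Fact p.Prime] (K : Type) [Field K] [NumberField K]
    [IsCyclotomicExtension {p} ℚ K] :
    ∃ (R : Type) (_ : CommRing R) (_ : IsDomain R) (ζ : R) (σ : R ≃+* R),
      IsPrimitiveRoot ζ p ∧ Prime (ζ - 1) ∧ (ζ - 1) ^ (p - 1) ∣ (p : R) ∧ σ ζ * ζ = 1 := by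
  have hp : p.Prime := Fact.out
  have hz : IsPrimitiveRoot (IsCyclotomicExtension.zeta p ℚ K) p :=
    IsCyclotomicExtension.zeta_spec p ℚ K
  have hirr := Polynomial.cyclotomic.irreducible_rat (n := p) hp.pos
  let τ : K ≃ₐ[ℚ] K := IsCyclotomicExtension.fromZetaAut (hz.inv) hirr
  have hτ : τ (IsCyclotomicExtension.zeta p ℚ K) = (IsCyclotomicExtension.zeta p ℚ K)⁻¹ :=
    IsCyclotomicExtension.fromZetaAut_spec (hz.inv) hirr
  refine ⟨NumberField.RingOfIntegers K, inferInstance, inferInstance, hz.toInteger,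
    NumberField.RingOfIntegers.mapRingEquiv τ.toRingEquiv, hz.toInteger_isPrimitiveRoot,
    hz.zeta_sub_one_prime', ?_, ?_⟩
  · exact (IsCyclotomicExtension.Rat.associated_zeta_sub_one_pow_prime p hz).dvd
  · apply NumberField.RingOfIntegers.ext
    have h : τ (IsCyclotomicExtension.zeta p ℚ K) * IsCyclotomicExtension.zeta p ℚ K = 1 := by
      rw [hτ, inv_mul_cancel₀ (hz.ne_zero hp.ne_zero)]
    exact h

lemma pm_exists_ring (p : ℕ) [Fact p.Prime] :
    ∃ (R : Type) (_ : CommRing R) (_ : IsDomain R) (ζ : R) (σ : R ≃+* R),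
      IsPrimitiveRoot ζ p ∧ Prime (ζ - 1) ∧ (ζ - 1) ^ (p - 1) ∣ (p : R) ∧ σ ζ * ζ = 1 := by
  have hp : p.Prime := Fact.out
  have : NeZero ((p : ℕ) : ℚ) := ⟨by exact_mod_cast hp.ne_zero⟩
  have : IsCyclotomicExtension {p} ℚ (CyclotomicField p ℚ) :=
    CyclotomicField.isCyclotomicExtension p ℚ
  exact pm_exists_ring_aux p (CyclotomicField p ℚ)

lemma pm_half {R : Type*} [CommRing R] [IsDomain R] (π : R) (hπ : Prime π) (σ : R ≃+* R)
    (h2 : σ π ∣ π) (N : ℕ) : ∀ S : R, π ^ (2 * N) ∣ S * σ S → π ^ N ∣ S := by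
  induction N with
  | zero => intro S _; simp
  | succ N ih =>
    intro S hS
    have hd : π ∣ S := by
      have : π ∣ S * σ S := (dvd_pow_self π (by omega)).trans hS
      rcases hπ.dvd_or_dvd this with h | h
      · exact h
      · have := h2.trans h
        exact (map_dvd_iff σ).1 this
    obtain ⟨T, rfl⟩ := hd
    have : π ^ (2 * N) ∣ T * σ T := by
      obtain ⟨c, hc⟩ := hS
      obtain ⟨w, hw⟩ := h2
      refine ⟨w * c, ?_⟩
      have h0 : π ^ 2 ≠ 0 := pow_ne_zero _ hπ.ne_zero
      apply mul_left_cancel₀ h0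
      rw [map_mul] at hc
      calc π ^ 2 * (T * σ T) = π * T * (σ π * w) * σ T := by rw [← hw]; ring
        _ = w * (π * T * (σ π * σ T)) := by ring
        _ = _ := by rw [hc]; ring
    rw [pow_succ']
    exact mul_dvd_mul_left _ (ih T this)

/-- expansion of `ζ ^ v - 1` -/
lemma pm_expand {R : Type*} [CommRing R] (ζ : R) (v : ℕ) :
    ∃ r : R, ζ ^ v - 1 = (ζ - 1) * (v + (ζ - 1) * r) := by
  induction v with
  | zero => exact ⟨0, by simp⟩
  | succ v ih =>
    obtain ⟨r, hr⟩ := ih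
    refine ⟨r + v + (ζ - 1) * r, ?_⟩
    have : ζ ^ (v+1) - 1 = (ζ ^ v - 1) * ((ζ - 1) + 1) + (ζ - 1) := by ring
    rw [this, hr]; push_cast; ring

lemma pm_prod_mod {R ι : Type*} [CommRing R] (s : Finset ι) (l : R) (v r : ι → R) :
    l ∣ (∏ i ∈ s, (v i + l * r i)) - ∏ i ∈ s, v i := by
  classical
  induction s using Finset.induction_on with
  | empty => simp
  | insert a s ha ih =>
    rw [Finset.prod_insert ha, Finset.prod_insert ha]
    obtain ⟨c, hc⟩ := ih
    refine ⟨v a * c + r a * ∏ i ∈ s, (v i + l * r i), ?_⟩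
    linear_combination v a * hc

lemma pm_char_sum {A R ι : Type*} [AddCommGroup A] [CommRing R] (ψ : AddChar A R) (s : Finset ι)
    (v : ι → A) : ψ (∑ i ∈ s, v i) = ∏ i ∈ s, ψ (v i) := by
  classical
  induction s using Finset.induction_on with
  | empty => simp
  | insert a s ha ih => rw [Finset.sum_insert ha, Finset.prod_insert ha, AddChar.map_add_eq_mul, ih]

/-- Ax-type lemma: high divisibility of all exponential sums kills low-degree moments. -/
lemma pm_moment (p : ℕ) [Fact p.Prime] {R : Type*} [CommRing R] [IsDomain R] (ζ : R)
    (hζ : IsPrimitiveRoot ζ p) (hπ : Prime (ζ - 1)) (hpd : ζ - 1 ∣ (p : R))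
    {X V : Type*} [Fintype X] [AddCommGroup V] (g : X → V)
    (M : ℕ) (hS : ∀ L : V →+ ZMod p, (ζ - 1) ^ M ∣ ∑ x, AddChar.zmodChar p hζ.pow_eq_one (L (g x)))
    {ι : Type*} [Fintype ι] (hι : Fintype.card ι < M) (L : ι → V →+ ZMod p) :
    ∑ x, ∏ i, L i (g x) = 0 := by
  classical
  set ψ := AddChar.zmodChar p hζ.pow_eq_one with hψ
  have h1 : (ζ - 1) ^ M ∣ ∑ x, ∏ i, (ψ (L i (g x)) - 1) := by
    have : ∀ x, ∏ i, (ψ (L i (g x)) - 1) =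
        ∑ t ∈ (Finset.univ : Finset ι).powerset,
          (ψ ((∑ i ∈ t, L i) (g x))) * ∏ i ∈ Finset.univ \ t, (-1 : R) := by
      intro x
      simp_rw [sub_eq_add_neg]
      rw [Finset.prod_add]
      refine Finset.sum_congr rfl fun t _ => ?_
      congr 1
      rw [AddMonoidHom.finsetSum_apply, pm_char_sum]
    simp_rw [this]
    rw [Finset.sum_comm]
    refine Finset.dvd_sum fun t _ => ?_
    rw [← Finset.sum_mul]
    exact (hS _).mul_right _
  choose r hr using fun v : ℕ => pm_expand ζ v
  have h2 : ∑ x, ∏ i, (ψ (L i (g x)) - 1) = (ζ - 1) ^ (Fintype.card ι) *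
      ∑ x, ∏ i, (((L i (g x)).val : R) + (ζ - 1) * r (L i (g x)).val) := by
    rw [Finset.mul_sum]
    refine Finset.sum_congr rfl fun x _ => ?_
    have : ∀ i, ψ (L i (g x)) - 1 =
        (ζ - 1) * (((L i (g x)).val : R) + (ζ - 1) * r (L i (g x)).val) := by
      intro i
      rw [← hr, hψ, AddChar.zmodChar_apply]
    simp_rw [this]
    rw [Finset.prod_mul_distrib]
    simp
  have h3 : (ζ - 1) ∣ ∑ x, ∏ i, (((L i (g x)).val : R) + (ζ - 1) * r (L i (g x)).val) := by
    have h4 : (ζ - 1) ^ (Fintype.card ι) * (ζ - 1) ∣ (ζ - 1) ^ (Fintype.card ι) *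
      ∑ x, ∏ i, (((L i (g x)).val : R) + (ζ - 1) * r (L i (g x)).val) := by
      rw [← h2, ← pow_succ]
      exact (pow_dvd_pow _ hι).trans h1
    exact (mul_dvd_mul_iff_left (pow_ne_zero _ hπ.ne_zero)).1 h4
  have h5 : (ζ - 1) ∣ ((∑ x, ∏ i, (L i (g x)).val : ℕ) : R) := by
    have h6 : (ζ - 1) ∣ (∑ x, ∏ i, (((L i (g x)).val : R) + (ζ - 1) * r (L i (g x)).val))
        - ∑ x, ∏ i, ((L i (g x)).val : R) := by
      rw [← Finset.sum_sub_distrib]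
      exact Finset.dvd_sum fun x _ => pm_prod_mod _ _ _ _
    have := (dvd_sub_right h3).1 h6
    push_cast
    exact this
  have h7 : p ∣ ∑ x, ∏ i, (L i (g x)).val := by
    by_contra hnd
    have hc := (Nat.Prime.coprime_iff_not_dvd (Fact.out : p.Prime)).2 hnd
    have hc' := (Nat.isCoprime_iff_coprime.2 hc)
    obtain ⟨a, b, hab⟩ := hc'
    have : (ζ - 1) ∣ 1 := by
      have h8 : ((a * (p:ℤ) + b * ((∑ x, ∏ i, (L i (g x)).val : ℕ) : ℤ) : ℤ) : R) = 1 := by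
        rw [hab]; simp
      refine Dvd.dvd.trans ?_ (dvd_of_eq h8)
      rw [Int.cast_add, Int.cast_mul, Int.cast_mul, Int.cast_natCast, Int.cast_natCast]
      exact dvd_add (hpd.mul_left _) (h5.mul_left _)
    exact hπ.not_isUnit (isUnit_of_dvd_one this)
  have h9 := (ZMod.natCast_eq_zero_iff _ p).2 h7
  push_cast at h9
  simpa using h9

/-- Divisibility of the exponential sums of a planar function. -/
lemma pm_expsum (p n : ℕ) [Fact p.Prime] {R : Type*} [CommRing R] [IsDomain R] (ζ : R)
    (σ : R ≃+* R) (hζ : IsPrimitiveRoot ζ p) (hπ : Prime (ζ - 1))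
    (hpd : (ζ - 1) ^ (p - 1) ∣ (p : R)) (hσ : σ ζ * ζ = 1)
    {F : Type*} [Field F] [Fintype F] (hF : Fintype.card F = p ^ n) (f : F → F)
    (hf : ∀ a : F, a ≠ 0 → Function.Bijective (fun x : F => f (x + a) - f x))
    (M : ℕ) (hM : 2 * M = n * (p - 1)) (L : F × F →+ ZMod p) :
    (ζ - 1) ^ M ∣ ∑ x, AddChar.zmodChar p hζ.pow_eq_one (L (x, f x)) := by
  classical
  set ψ := AddChar.zmodChar p hζ.pow_eq_one with hψ
  have hinj : ∀ a, ψ a = 1 → a = 0 := by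
    intro a ha
    rw [hψ, AddChar.zmodChar_apply] at ha
    have := (hζ.pow_eq_one_iff_dvd _).1 ha
    have h2 := Nat.eq_zero_of_dvd_of_lt this (ZMod.val_lt a)
    exact (ZMod.val_eq_zero a).1 h2
  have hq : (ζ - 1) ^ (2 * M) ∣ ((p ^ n : ℕ) : R) := by
    rw [hM, mul_comm, pow_mul, Nat.cast_pow]
    exact pow_dvd_pow_of_dvd hpd n
  have hzero : ∀ m : F →+ ZMod p, m ≠ 0 → ∑ z, ψ (m z) = 0 := by
    intro m hm
    have : (ψ.compAddMonoidHom m) ≠ 1 := by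
      intro h
      apply hm
      ext z
      apply hinj
      have := DFunLike.congr_fun h z
      simpa using this
    have h2 := AddChar.sum_eq_zero_of_ne_one this
    simpa using h2
  set l : F →+ ZMod p := L.comp (AddMonoidHom.inl F F) with hl
  set m : F →+ ZMod p := L.comp (AddMonoidHom.inr F F) with hm
  have hL : ∀ x y, L (x, y) = l x + m y := by
    intro x y
    rw [hl, hm]
    simp [← map_add]
  by_cases hm0 : m = 0
  · have : ∀ x, L (x, f x) = l x := by intro x; rw [hL, hm0]; simp
    simp_rw [this]
    by_cases hl0 : l = 0
    · rw [hl0]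
      simp only [AddMonoidHom.zero_apply, AddChar.map_zero_eq_one, Finset.sum_const,
        Finset.card_univ, hF, nsmul_eq_mul, mul_one]
      exact (pow_dvd_pow _ (by omega)).trans hq
    · rw [hzero l hl0]; exact dvd_zero _
  · have hσψ : ∀ a, σ (ψ a) = ψ (-a) := by
      intro a
      have h1 : σ (ψ a) * ψ a = 1 := by
        rw [hψ, AddChar.zmodChar_apply, map_pow, ← mul_pow, hσ, one_pow]
      have h2 : ψ (-a) * ψ a = 1 := by
        rw [← AddChar.map_add_eq_mul]; simp
      have h3 : ψ a ≠ 0 := right_ne_zero_of_mul_eq_one h1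
      exact mul_right_cancel₀ h3 (h1.trans h2.symm)
    have hprod : (∑ x, ψ (L (x, f x))) * σ (∑ x, ψ (L (x, f x))) = ((p ^ n : ℕ) : R) := by
      rw [map_sum, Finset.sum_mul_sum, Finset.sum_comm]
      have h1 : ∀ y, ∑ x, ψ (L (x, f x)) * σ (ψ (L (y, f y))) =
          ∑ u, ψ (l u) * ψ (m (f (y + u) - f y)) := by
        intro y
        rw [← Equiv.sum_comp (Equiv.addLeft y)]
        refine Finset.sum_congr rfl fun u _ => ?_
        rw [hσψ, ← AddChar.map_add_eq_mul, ← AddChar.map_add_eq_mul]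
        congr 1
        simp only [Equiv.coe_addLeft, hL, map_add, map_sub]
        ring
      simp_rw [h1]
      rw [Finset.sum_comm]
      simp_rw [← Finset.mul_sum]
      rw [Finset.sum_eq_single 0]
      · simp [hF]
      · intro u _ hu
        have h2 := (hf u hu).sum_comp (fun z => ψ (m z))
        rw [h2, hzero m hm0, mul_zero]
      · simp
    apply pm_half (ζ - 1) hπ σ
    · refine ⟨-ζ, ?_⟩
      rw [map_sub, map_one]
      linear_combination hσ
    · rw [hprod]; exact hq

/-- Moments of a planar function over the field itself. -/
lemma pm_moment_field (p n : ℕ) [Fact p.Prime]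
    {F : Type*} [Field F] [Fintype F] [Algebra (ZMod p) F] (hF : Fintype.card F = p ^ n) (f : F → F)
    (hf : ∀ a : F, a ≠ 0 → Function.Bijective (fun x : F => f (x + a) - f x))
    (M : ℕ) (hM : 2 * M = n * (p - 1)) {ι : Type*} [Fintype ι] (hι : Fintype.card ι < M)
    (τ : ι → ℕ) (b : ι → Bool) :
    ∑ x, ∏ i, (if b i then f x else x) ^ (p ^ τ i) = 0 := by
  classical
  obtain ⟨R, _, _, ζ, σ, hζ, hπ, hpd, hσ⟩ := pm_exists_ring p
  have hp : p.Prime := Fact.out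
  have hp1 : ζ - 1 ∣ (p : R) := (dvd_pow_self _ (by have := hp.two_le; omega)).trans hpd
  have key := fun (L : ι → F × F →+ ZMod p) => pm_moment p ζ hζ hπ hp1 (fun x : F => (x, f x)) M
    (pm_expsum p n ζ σ hζ hπ hpd hσ hF f hf M hM) hι L
  have : CharP F p := charP_of_injective_algebraMap (algebraMap (ZMod p) F).injective p
  have : ExpChar F p := ExpChar.prime hp
  let B := Module.finBasis (ZMod p) F
  let pr : Bool → (F × F →+ F) := fun c => if c then AddMonoidHom.snd F F else AddMonoidHom.fst F F
  have hexp : ∀ (y : F) (t : ℕ), y ^ (p ^ t) =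
      ∑ c, algebraMap (ZMod p) F (B.coord c y) * (B c) ^ (p ^ t) := by
    intro y t
    conv_lhs => rw [← B.sum_repr y]
    rw [sum_pow_char_pow]
    refine Finset.sum_congr rfl fun c _ => ?_
    rw [Algebra.smul_def, mul_pow, ← map_pow, ZMod.pow_card_pow]
    rfl
  have hpr : ∀ (i : ι) (x : F), (if b i then f x else x) = pr (b i) (x, f x) := by
    intro i x
    cases h : b i <;> simp [pr]
  have hx : ∀ x : F, ∏ i, (if b i then f x else x) ^ (p ^ τ i) =
      ∑ c ∈ Fintype.piFinset (fun _ : ι => (Finset.univ : Finset (Fin (Module.finrank (ZMod p) F)))),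
        ∏ i, (algebraMap (ZMod p) F (B.coord (c i) (pr (b i) (x, f x))) * (B (c i)) ^ (p ^ τ i)) := by
    intro x
    rw [← Finset.prod_univ_sum (fun _ : ι => (Finset.univ : Finset (Fin (Module.finrank (ZMod p) F))))
      (fun i c => algebraMap (ZMod p) F (B.coord c (pr (b i) (x, f x))) * (B c) ^ (p ^ τ i))]
    refine Finset.prod_congr rfl fun i _ => ?_
    rw [← hexp, hpr]
  simp_rw [hx]
  rw [Finset.sum_comm]
  refine Finset.sum_eq_zero fun c _ => ?_
  simp_rw [Finset.prod_mul_distrib]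
  rw [← Finset.sum_mul]
  have := key (fun i => ((B.coord (c i)).toAddMonoidHom).comp (pr (b i)))
  have h2 := congrArg (algebraMap (ZMod p) F) this
  rw [map_sum, map_zero] at h2
  simp_rw [map_prod] at h2
  convert zero_mul _ using 2
  exact h2

/-- Digit criterion -/
lemma pm_digit (p n k : ℕ) [Fact p.Prime]
    {F : Type*} [Field F] [Fintype F] [Algebra (ZMod p) F] (hF : Fintype.card F = p ^ n)
    (hf : ∀ a : F, a ≠ 0 → Function.Bijective (fun x : F => (x + a) ^ k - x ^ k))
    (M : ℕ) (hM : 2 * M = n * (p - 1)) (e d : Fin n → ℕ)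
    (hed : ∑ t, e t + ∑ t, d t < M)
    (hpos : 0 < ∑ t, e t * p ^ (t : ℕ) + k * ∑ t, d t * p ^ (t : ℕ)) :
    ¬ (p ^ n - 1 ∣ ∑ t, e t * p ^ (t : ℕ) + k * ∑ t, d t * p ^ (t : ℕ)) := by
  classical
  intro hdvd
  have key := pm_moment_field p n hF (fun x => x ^ k) hf M hM
    (ι := (Σ t : Fin n, Fin (e t)) ⊕ (Σ t : Fin n, Fin (d t))) (by simpa using hed)
    (Sum.elim (fun s => (s.1 : ℕ)) (fun s => (s.1 : ℕ))) (Sum.elim (fun _ => false) (fun _ => true))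
  have h1 : ∀ x : F, ∏ i : (Σ t : Fin n, Fin (e t)) ⊕ (Σ t : Fin n, Fin (d t)),
      (if (Sum.elim (fun _ => false) (fun _ => true) i : Bool) then x ^ k else x) ^
        (p ^ (Sum.elim (fun s => (s.1 : ℕ)) (fun s => (s.1 : ℕ)) i : ℕ)) =
      x ^ (∑ t, e t * p ^ (t : ℕ) + k * ∑ t, d t * p ^ (t : ℕ)) := by
    intro x
    rw [Fintype.prod_sum_type, Fintype.prod_sigma, Fintype.prod_sigma]
    simp only [Sum.elim_inl, Sum.elim_inr, if_true, Bool.false_eq_true, if_false]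
    simp only [Finset.prod_const, Finset.card_univ, Fintype.card_fin, ← pow_mul]
    rw [Finset.prod_pow_eq_pow_sum, Finset.prod_pow_eq_pow_sum, ← pow_add, Finset.mul_sum]
    congr 1
    congr 1
    · exact Finset.sum_congr rfl fun t _ => by ring
    · exact Finset.sum_congr rfl fun t _ => by ring
  simp_rw [h1] at key
  have h2 := FiniteField.sum_pow_units F (∑ t, e t * p ^ (t : ℕ) + k * ∑ t, d t * p ^ (t : ℕ))
  rw [hF, if_pos hdvd] at h2
  have h3 : ∑ x : F, x ^ (∑ t, e t * p ^ (t : ℕ) + k * ∑ t, d t * p ^ (t : ℕ)) = -1 := by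
    rw [← h2, ← Finset.sum_subset (Finset.subset_univ (Finset.univ.erase (0 : F)))]
    · symm
      refine Finset.sum_bij (fun (u : Fˣ) _ => (u : F)) ?_ ?_ ?_ ?_
      · intro u _; simp
      · intro u _ v _ h; exact Units.ext h
      · intro x hx
        exact ⟨Units.mk0 x (by simpa using hx), Finset.mem_univ _, rfl⟩
      · intro u _; simp
    · intro x _ hx
      have : x = 0 := by simpa using hx
      rw [this, zero_pow hpos.ne']
  rw [h3] at key
  simp at key

/-- Planarity of the monomial `X ^ k`, in injective form. -/
def PMPlanar (F : Type*) [Field F] (k : ℕ) : Prop :=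
  ∀ a : F, a ≠ 0 → Function.Injective (fun x : F => (x + a) ^ k - x ^ k)

lemma PMPlanar.sub {F K : Type*} [Field F] [Field K] {k : ℕ} (h : PMPlanar F k) (φ : K →+* F) :
    PMPlanar K k := by
  intro a ha x y hxy
  apply φ.injective
  apply h (φ a) (by simpa using ha)
  simpa using congrArg φ hxy

lemma PMPlanar.frob {F : Type*} [Field F] {k : ℕ} (h : PMPlanar F k) (p : ℕ) [Fact p.Prime]
    [CharP F p] : PMPlanar F (k * p) := by
  intro a ha x y hxy
  apply h a ha
  apply frobenius_inj F p
  simpa [frobenius_def, pow_mul, sub_pow_char] using hxy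

lemma PMPlanar.even {F : Type*} [Field F] {k : ℕ} (h : PMPlanar F k) (h2 : (2 : F) ≠ 0) :
    Even k := by
  by_contra hk
  have hk : Odd k := by simpa using hk
  have := @h 1 one_ne_zero 0 (-1) (by simp [hk.neg_pow, hk.pos.ne'])
  simp at this

lemma PMPlanar.inj {F : Type*} [Field F] {k : ℕ} (h : PMPlanar F k) (h2 : (2 : F) ≠ 0)
    {x y : F} (hxy : x ^ k = y ^ k) : x = y ∨ x = -y := by
  have hk := h.even h2
  by_cases hne : x = y
  · exact Or.inl hne
  right
  have ha : x - y ≠ 0 := sub_ne_zero.2 hne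
  have h1 := @h (x - y) ha y (-((x - y) / 2)) (by
    have e1 : y + (x - y) = x := by ring
    have e2 : -((x - y) / 2) + (x - y) = (x - y) / 2 := by field_simp; ring
    simp only [e1, e2, hk.neg_pow, hxy, sub_self])
  field_simp at h1
  linear_combination h1

lemma PMPlanar.gcd {F : Type*} [Field F] [Fintype F] {k : ℕ} (h : PMPlanar F k)
    (h2 : (2 : F) ≠ 0) (c : ℕ) (hc : 2 < c) (hck : c ∣ k) (hcq : c ∣ Fintype.card F - 1) :
    False := by
  classical
  obtain ⟨g, hg⟩ := IsCyclic.exists_generator (α := Fˣ)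
  have ho : orderOf g = Fintype.card F - 1 := by
    rw [orderOf_eq_card_of_forall_mem_zpowers hg, Nat.card_eq_fintype_card, Fintype.card_units]
  obtain ⟨m, hm⟩ := hcq
  have hq : 1 < Fintype.card F := Fintype.one_lt_card
  have hm0 : m ≠ 0 := by rintro rfl; omega
  have hoc : orderOf (g ^ m) = c := by
    rw [orderOf_pow_of_dvd hm0 (by rw [ho, hm]; exact dvd_mul_left _ _), ho, hm]
    exact Nat.mul_div_cancel _ (Nat.pos_of_ne_zero hm0)
  have hk1 : (g ^ m) ^ k = 1 := orderOf_dvd_iff_pow_eq_one.1 (hoc ▸ hck)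
  have hk2 : ((g ^ m : Fˣ) : F) ^ k = 1 ^ k := by
    rw [one_pow, ← Units.val_pow_eq_pow_val, hk1]; rfl
  have h3 : (g ^ m) ^ 2 = 1 := by
    apply Units.ext
    rw [Units.val_pow_eq_pow_val]
    rcases h.inj h2 hk2 with h | h <;> rw [h] <;> simp
  have := Nat.le_of_dvd (by norm_num) (orderOf_dvd_of_pow_eq_one h3)
  omega

lemma PMPlanar.bij {F : Type*} [Field F] [Fintype F] {k : ℕ} (h : PMPlanar F k) :
    ∀ a : F, a ≠ 0 → Function.Bijective (fun x : F => (x + a) ^ k - x ^ k) :=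
  fun a ha => Finite.injective_iff_bijective.1 (h a ha)

/-- Arithmetic of the prime field case. -/
lemma pm_arith (h k : ℕ) (hh : 2 ≤ h)
    (H : ∀ e d : ℕ, 0 < d → e + d < h → ¬ (2 * h ∣ e + k * d)) (hk : Even k) :
    k % (2 * h) = 2 ∨ k % (2 * h) = h + 1 := by
  obtain ⟨r, t, hr, hkr⟩ : ∃ r t, r < 2 * h ∧ k = r + 2 * h * t :=
    ⟨k % (2 * h), k / (2 * h), Nat.mod_lt _ (by omega), (Nat.mod_add_div _ _).symm⟩
  have hmod : k % (2 * h) = r := by rw [hkr, Nat.add_mul_mod_self_left, Nat.mod_eq_of_lt hr]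
  rw [hmod]
  have H' : ∀ e d c : ℕ, 0 < d → e + d < h → e + r * d = 2 * h * c → False := by
    intro e d c hd hed hc
    apply H e d hd hed
    refine ⟨c + t * d, ?_⟩
    rw [hkr]
    linear_combination hc
  have hre : Even r := by
    rw [hkr] at hk
    have : Even (2 * h * t) := by rw [mul_assoc]; exact even_two_mul _
    exact (Nat.even_add.1 hk).2 this
  by_contra hcon
  push Not at hcon
  obtain ⟨hc2, hch⟩ := hcon
  obtain ⟨r', hr'⟩ := hre
  have hr0 : r ≠ 0 := by
    rintro rfl
    exact H' 0 1 0 (by omega) (by omega) (by ring)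
  have hrh : r ≤ h := by
    by_contra hlt
    exact H' (2 * h - r) 1 1 (by omega) (by omega) (by omega)
  have hr4 : 4 ≤ r := by omega
  set d := 2 * h / r with hd
  have hd1 : d * r ≤ 2 * h := Nat.div_mul_le_self _ _
  have hd2 : 2 * h < d * r + r := by
    have := Nat.lt_div_mul_add (a := 2 * h) (b := r) (by omega)
    exact this
  have hdge : 2 ≤ d := by
    rw [hd, Nat.le_div_iff_mul_le (by omega)]; omega
  have hlt : ¬ (2 * h - d * r + d < h) := fun hl =>
    H' (2 * h - d * r) d 1 (by omega) hl (by
      have : r * d = d * r := mul_comm _ _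
      omega)
  by_cases hd3 : 3 ≤ d
  · by_cases hh9 : 9 ≤ h
    · apply hlt
      have : 3 * r + 4 * d ≤ d * r + 12 := by
        obtain ⟨a, rfl⟩ := Nat.exists_eq_add_of_le hr4
        obtain ⟨b, hb⟩ := Nat.exists_eq_add_of_le hd3
        rw [hb]; nlinarith [Nat.zero_le (a * b)]
      omega
    · have : h < 9 := by omega
      have hr8 : r ≤ 8 := by omega
      have hdle : d ≤ 4 := by
        by_contra hdd
        have : 5 ≤ d := by omega
        nlinarith
      generalize d = d at *
      interval_cases r <;> interval_cases d <;> omega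
  · have : d = 2 := by omega
    rw [this] at hlt hd2
    apply hlt
    omega

lemma pm_prime_field (p k : ℕ) [Fact p.Prime] (hp5 : 5 ≤ p) (hpl : PMPlanar (ZMod p) k) :
    k % (p - 1) = 2 := by
  have hp : p.Prime := Fact.out
  have h0 : ∀ m : ℕ, 0 < m → m < p → ((m : ℕ) : ZMod p) ≠ 0 := by
    intro m hm hmp h
    exact absurd (Nat.le_of_dvd hm ((ZMod.natCast_eq_zero_iff m p).1 h)) (by omega)
  have h2 : (2 : ZMod p) ≠ 0 := by exact_mod_cast h0 2 (by omega) (by omega)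
  have h3 : (3 : ZMod p) ≠ 0 := by exact_mod_cast h0 3 (by omega) (by omega)
  have hke := hpl.even h2
  obtain ⟨h, hh⟩ : ∃ h, p = 2 * h + 1 := hp.odd_of_ne_two (by omega)
  have hph : p - 1 = 2 * h := by omega
  have hk0 : 0 < k := by
    rcases Nat.eq_zero_or_pos k with h | h
    · subst h
      have := @hpl 1 one_ne_zero 0 1 (by simp)
      simp at this
    · exact h
  rcases pm_arith h k (by omega) (by
    intro e d hd hed hdvd
    have := pm_digit p 1 k (F := ZMod p) (by simp) hpl.bij h (by omega) (fun _ => e) (fun _ => d)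
      (by simpa using hed) (by simp; right; exact ⟨hk0, hd⟩)
    apply this
    simpa [hph] using hdvd) hke with h | h'
  · rw [hph]; exact h
  · exfalso
    have hk := Nat.mod_add_div k (2 * h)
    rw [h'] at hk
    set t := k / (2 * h)
    have hf : ∀ x : ZMod p, x ≠ 0 → x ^ k = x ∨ x ^ k = -x := by
      intro x hx
      apply sq_eq_sq_iff_eq_or_eq_neg.1
      have : k * 2 = 2 + (p - 1) * (1 + 2 * t) := by
        rw [hph, ← hk]; ring
      rw [← pow_mul, this, pow_add, pow_mul, ZMod.pow_card_sub_one_eq_one hx, one_pow, mul_one]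
    have h4 : (4 : ZMod p) ^ k = 4 := by
      have : (4 : ZMod p) = 2 ^ 2 := by norm_num
      rw [this, ← pow_mul, mul_comm, pow_mul]
      rcases hf 2 h2 with h | h <;> (rw [h]; try ring)
    rcases hf 2 h2 with ha | ha
    · have := @hpl 1 one_ne_zero 1 0 (by
        simp only [zero_add, one_pow, zero_pow hk0.ne']
        have : (1 + 1 : ZMod p) = 2 := by norm_num
        rw [this, ha]; norm_num)
      simp at this
    · rcases hf 3 h3 with hb | hb
      · have := @hpl 1 one_ne_zero 3 0 (by
          simp only [zero_add, one_pow, zero_pow hk0.ne']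
          have : (3 + 1 : ZMod p) = 4 := by norm_num
          rw [this, h4, hb]; norm_num)
        exact h3 this
      · have := @hpl 1 one_ne_zero 2 (-1) (by
          simp only [neg_add_cancel, zero_pow hk0.ne', hke.neg_pow, one_pow]
          have : (2 + 1 : ZMod p) = 3 := by norm_num
          rw [this, ha, hb]; norm_num)
        apply h3
        linear_combination this

lemma pm_d2 (p k K : ℕ) [Fact p.Prime] (hk : 0 < k)
    {F : Type*} [Field F] [Fintype F] [Algebra (ZMod p) F] (hF : Fintype.card F = p ^ 2)
    (hpl : PMPlanar F k) (hK : k ≡ K [MOD p ^ 2 - 1]) (e0 e1 d0 d1 : ℕ)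
    (hs : e0 + e1 + (d0 + d1) < p - 1) (hd : 0 < d0 + d1 * p)
    (c : ℤ) (h : ((e0 + e1 * p + K * (d0 + d1 * p) : ℕ) : ℤ) = ((p : ℤ) ^ 2 - 1) * c) : False := by
  have hp : p.Prime := Fact.out
  refine pm_digit p 2 k hF hpl.bij (p - 1) (by ring) ![e0, e1] ![d0, d1]
    (by simpa [Fin.sum_univ_two] using hs) ?_ ?_
  · have : 0 < k * (d0 + d1 * p) := Nat.mul_pos hk hd
    simp only [Fin.sum_univ_two, Matrix.cons_val_zero, Matrix.cons_val_one, Fin.val_zero,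
      Fin.val_one, pow_zero, pow_one, mul_one]
    omega
  · simp only [Fin.sum_univ_two, Matrix.cons_val_zero, Matrix.cons_val_one, Fin.val_zero,
      Fin.val_one, pow_zero, pow_one, mul_one]
    have h1 : e0 + e1 * p + k * (d0 + d1 * p) ≡ e0 + e1 * p + K * (d0 + d1 * p) [MOD p ^ 2 - 1] :=
      (Nat.ModEq.mul_right _ hK).add_left _
    rw [h1.dvd_iff dvd_rfl]
    have h2 : ((p ^ 2 - 1 : ℕ) : ℤ) = (p : ℤ) ^ 2 - 1 := by
      rw [Nat.cast_sub (Nat.one_le_pow _ _ hp.pos)]; push_cast; ring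
    rw [← Int.natCast_dvd_natCast, h2]
    exact ⟨c, h⟩

lemma pm_d4 (p k K : ℕ) [Fact p.Prime] (hk : 0 < k)
    {F : Type*} [Field F] [Fintype F] [Algebra (ZMod p) F] (hF : Fintype.card F = p ^ 4)
    (hpl : PMPlanar F k) (hK : k ≡ K [MOD p ^ 4 - 1]) (e0 e1 e2 e3 d0 d1 d2 : ℕ)
    (hs : e0 + e1 + e2 + e3 + (d0 + d1 + d2) < 2 * (p - 1)) (hd : 0 < d0 + d1 * p + d2 * p ^ 2)
    (c : ℤ) (h : ((e0 + e1 * p + e2 * p ^ 2 + e3 * p ^ 3 +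
      K * (d0 + d1 * p + d2 * p ^ 2) : ℕ) : ℤ) = ((p : ℤ) ^ 4 - 1) * c) : False := by
  have hp : p.Prime := Fact.out
  have se : ∑ t : Fin 4, (![e0, e1, e2, e3] : Fin 4 → ℕ) t * p ^ (t : ℕ) =
      e0 + e1 * p + e2 * p ^ 2 + e3 * p ^ 3 := by
    simp [Fin.sum_univ_four]
  have sd : ∑ t : Fin 4, (![d0, d1, d2, 0] : Fin 4 → ℕ) t * p ^ (t : ℕ) =
      d0 + d1 * p + d2 * p ^ 2 := by
    simp [Fin.sum_univ_four]
  refine pm_digit p 4 k hF hpl.bij (2 * (p - 1)) (by ring) ![e0, e1, e2, e3] ![d0, d1, d2, 0]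
    (by simpa [Fin.sum_univ_four] using hs) ?_ ?_
  · rw [se, sd]
    have : 0 < k * (d0 + d1 * p + d2 * p ^ 2) := Nat.mul_pos hk hd
    omega
  · rw [se, sd]
    have h1 : e0 + e1 * p + e2 * p ^ 2 + e3 * p ^ 3 + k * (d0 + d1 * p + d2 * p ^ 2) ≡
      e0 + e1 * p + e2 * p ^ 2 + e3 * p ^ 3 + K * (d0 + d1 * p + d2 * p ^ 2) [MOD p ^ 4 - 1] :=
      (Nat.ModEq.mul_right _ hK).add_left _
    rw [h1.dvd_iff dvd_rfl]
    have h2 : ((p ^ 4 - 1 : ℕ) : ℤ) = (p : ℤ) ^ 4 - 1 := by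
      rw [Nat.cast_sub (Nat.one_le_pow _ _ hp.pos)]; push_cast; ring
    rw [← Int.natCast_dvd_natCast, h2]
    exact ⟨c, h⟩

/-- Field of order `p ^ 2`. -/
lemma pm_square_field (p k : ℕ) [Fact p.Prime] (hp5 : 5 ≤ p) (hk : 0 < k)
    {F : Type*} [Field F] [Fintype F] [Algebra (ZMod p) F] (hF : Fintype.card F = p ^ 2)
    (hpl : PMPlanar F k) :
    k ≡ 2 [MOD p ^ 2 - 1] ∨ k ≡ 2 * p [MOD p ^ 2 - 1] ∨ k ≡ p + 1 [MOD p ^ 2 - 1] := by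
  have h1 := pm_prime_field p k hp5 (hpl.sub (algebraMap (ZMod p) F))
  have hp1 : p - 1 ∣ p ^ 2 - 1 := by simpa using Nat.sub_dvd_pow_sub_pow p 1 2
  have hp2 : 1 < p ^ 2 := Nat.one_lt_pow (by norm_num) (by omega)
  obtain ⟨K, hKdef⟩ : ∃ K, K = k % (p ^ 2 - 1) := ⟨_, rfl⟩
  have hK : k ≡ K [MOD p ^ 2 - 1] := by rw [hKdef]; exact (Nat.mod_modEq _ _).symm
  have hKlt : K < p ^ 2 - 1 := by rw [hKdef]; exact Nat.mod_lt _ (by omega)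
  have hK2 : K ≡ 2 [MOD p - 1] := by
    have := (hK.of_dvd hp1).symm
    refine this.trans ?_
    rw [Nat.ModEq, h1, Nat.mod_eq_of_lt (by omega)]
  obtain ⟨a, b, hab, ha, hb⟩ : ∃ a b, K = a + b * p ∧ a < p ∧ b < p := by
    refine ⟨K % p, K / p, ?_, Nat.mod_lt _ (by omega), ?_⟩
    · rw [mul_comm]; exact (Nat.mod_add_div _ _).symm
    · rw [Nat.div_lt_iff_lt_mul (by omega)]
      have : p ^ 2 = p * p := sq p
      omega
  have hab2 : a + b ≡ 2 [MOD p - 1] := by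
    refine Nat.ModEq.trans ?_ hK2
    rw [hab]
    apply Nat.ModEq.add_left
    have hpp : p ≡ 1 [MOD p - 1] := by
      refine ((Nat.modEq_iff_dvd' (by omega)).2 dvd_rfl).symm
    simpa using (Nat.ModEq.mul_left b hpp).symm
  have hcase : a + b = 2 ∨ a + b = p + 1 := by
    obtain ⟨t, ht⟩ := (Nat.modEq_iff_dvd.1 hab2.symm)
    have hp' : ((p - 1 : ℕ) : ℤ) = (p : ℤ) - 1 := by omega
    rw [hp'] at ht
    have ht0 : 0 ≤ t := by
      by_contra hneg
      have : t ≤ -1 := by omega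
      have : ((p : ℤ) - 1) * t ≤ ((p : ℤ) - 1) * (-1) := mul_le_mul_of_nonneg_left this (by omega)
      push_cast at ht
      omega
    have ht1 : t ≤ 1 := by
      by_contra hneg
      have : 2 ≤ t := by omega
      have : ((p : ℤ) - 1) * 2 ≤ ((p : ℤ) - 1) * t := mul_le_mul_of_nonneg_left this (by omega)
      push_cast at ht
      omega
    have : t = 0 ∨ t = 1 := by omega
    rcases this with rfl | rfl
    · left; push_cast at ht; omega
    · right; push_cast at ht; omega
  rcases hcase with h | h
  · have : b = 0 ∨ b = 1 ∨ b = 2 := by omega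
    rcases this with rfl | rfl | rfl
    · left
      have : K = 2 := by omega
      rwa [this] at hK
    · right; right
      have : K = p + 1 := by omega
      rwa [this] at hK
    · right; left
      have : K = 2 * p := by omega
      rwa [this] at hK
  · exfalso
    obtain ⟨e0, he0⟩ : ∃ e0, e0 + a + 1 = p := ⟨p - 1 - a, by omega⟩
    obtain ⟨e1, he1⟩ : ∃ e1, e1 + b + 1 = p := ⟨p - 1 - b, by omega⟩
    refine pm_d2 p k K hk hF hpl hK e0 e1 1 0 (by omega) (by omega) 1 ?_
    rw [hab]
    have z0 : (e0 : ℤ) = p - 1 - a := by omega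
    have z1 : (e1 : ℤ) = p - 1 - b := by omega
    push_cast
    rw [z0, z1]
    ring

/-- The exceptional exponents `1 + k1 p + k3 p ^ 3`. -/
lemma pm_exceptional (p k k1 k3 : ℕ) [Fact p.Prime] (hp5 : 5 ≤ p) (hk : 0 < k)
    {F : Type*} [Field F] [Fintype F] [Algebra (ZMod p) F] (hF : Fintype.card F = p ^ 4)
    (hpl : PMPlanar F k) (h13 : k1 + k3 = p) (hk1 : k1 < p) (hk3 : k3 < p)
    (hK : k ≡ 1 + k1 * p + k3 * p ^ 3 [MOD p ^ 4 - 1]) : False := by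
  have hp : p.Prime := Fact.out
  have z3 : (k3 : ℤ) = p - k1 := by omega
  by_cases ha : k1 = 1
  · subst ha
    obtain ⟨e1, he1⟩ : ∃ e1, e1 + 5 = p := ⟨p - 5, by omega⟩
    obtain ⟨e2, he2⟩ : ∃ e2, e2 + 3 = p := ⟨p - 3, by omega⟩
    refine pm_d4 p k _ hk hF hpl hK 0 e1 e2 0 1 2 0 (by omega) (by omega) (2 * p - 1) ?_
    have z1 : (e1 : ℤ) = p - 5 := by omega
    have z2 : (e2 : ℤ) = p - 3 := by omega
    push_cast
    rw [z1, z2, z3]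
    push_cast
    ring
  by_cases hb : k3 = 1
  · subst hb
    obtain ⟨h, hh⟩ : ∃ h, p = 2 * h + 1 := hp.odd_of_ne_two (by omega)
    obtain ⟨d0, hd0⟩ : ∃ d0, d0 + 1 = h := ⟨h - 1, by omega⟩
    obtain ⟨e1, he1⟩ : ∃ e1, e1 + 4 = p := ⟨p - 4, by omega⟩
    refine pm_d4 p k _ hk hF hpl hK 0 e1 1 0 d0 1 (h + 1) (by omega) (by omega) ((h + 1) * p + h + 2) ?_
    have z0 : (d0 : ℤ) = h - 1 := by omega
    have z1 : (e1 : ℤ) = p - 4 := by omega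
    have z2 : (k1 : ℤ) = p - 1 := by omega
    have zp : (p : ℤ) = 2 * h + 1 := by omega
    push_cast
    rw [z0, z1, z2, zp]
    ring
  · obtain ⟨e0, he0⟩ : ∃ e0, e0 + k3 + 2 = p := ⟨p - 2 - k3, by omega⟩
    obtain ⟨e1, he1⟩ : ∃ e1, e1 + k1 + 2 = p := ⟨p - 2 - k1, by omega⟩
    refine pm_d4 p k _ hk hF hpl hK e0 e1 (e1 + 1) (e0 + 1) 1 1 0 (by omega) (by omega)
      (1 + k3) ?_
    have z0 : (e0 : ℤ) = p - 2 - k3 := by omega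
    have z1 : (e1 : ℤ) = p - 2 - k1 := by omega
    push_cast
    rw [z0, z1, z3]
    ring

/-- Exponents congruent to `2` modulo `p ^ 2 - 1`. -/
lemma pm_main_aux (p k : ℕ) [Fact p.Prime] (hp5 : 5 ≤ p) (hk : 0 < k)
    {F : Type*} [Field F] [Fintype F] [Algebra (ZMod p) F] (hF : Fintype.card F = p ^ 4)
    (h2 : (2 : F) ≠ 0) [CharP F p]
    (hpl : PMPlanar F k) (hk2 : k ≡ 2 [MOD p ^ 2 - 1]) :
    k ≡ 2 [MOD p ^ 4 - 1] ∨ k ≡ 2 * p ^ 2 [MOD p ^ 4 - 1] := by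
  have hpp : 25 ≤ p ^ 2 := by nlinarith
  have hp42 : p ^ 4 - 1 = (p ^ 2 - 1) * (p ^ 2 + 1) := by
    zify [Nat.one_le_pow 4 p (by omega), Nat.one_le_pow 2 p (by omega)]; ring
  have hp4 : 1 < p ^ 4 := Nat.one_lt_pow (by norm_num) (by omega)
  obtain ⟨K, hKdef⟩ : ∃ K, K = k % (p ^ 4 - 1) := ⟨_, rfl⟩
  have hK : k ≡ K [MOD p ^ 4 - 1] := by rw [hKdef]; exact (Nat.mod_modEq _ _).symm
  have hKlt : K < p ^ 4 - 1 := by rw [hKdef]; exact Nat.mod_lt _ (by omega)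
  have hK2 : K ≡ 2 [MOD p ^ 2 - 1] :=
    ((hK.of_dvd (by rw [hp42]; exact dvd_mul_right _ _)).symm).trans hk2
  obtain ⟨k0, k1, k2, k3, hKd, l0, l1, l2, l3⟩ : ∃ k0 k1 k2 k3,
      K = k0 + k1 * p + k2 * p ^ 2 + k3 * p ^ 3 ∧ k0 < p ∧ k1 < p ∧ k2 < p ∧ k3 < p := by
    have hp0 : 0 < p := by omega
    refine ⟨K % p, K / p % p, K / p / p % p, K / p / p / p, ?_, Nat.mod_lt _ hp0, Nat.mod_lt _ hp0,
      Nat.mod_lt _ hp0, ?_⟩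
    · have a1 := Nat.mod_add_div K p
      have a2 := Nat.mod_add_div (K / p) p
      have a3 := Nat.mod_add_div (K / p / p) p
      linear_combination -a1 - p * a2 - p ^ 2 * a3
    · rw [Nat.div_div_eq_div_mul, Nat.div_div_eq_div_mul, Nat.div_lt_iff_lt_mul (by positivity)]
      have : p * (p * (p * p)) = p ^ 4 := by ring
      omega
  obtain ⟨t, ht⟩ := Nat.modEq_iff_dvd.1 hK2.symm
  have hc2 : ((p ^ 2 - 1 : ℕ) : ℤ) = (p : ℤ) ^ 2 - 1 := by
    rw [Nat.cast_sub (by omega)]; push_cast; ring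
  rw [hc2, hKd] at ht
  push_cast at ht
  have hppz : (25 : ℤ) ≤ (p : ℤ) ^ 2 := by exact_mod_cast hpp
  obtain ⟨u, hu⟩ : ∃ u : ℤ, u = t - (k2 + k3 * p) := ⟨_, rfl⟩
  have hu2 : (k0 : ℤ) + k2 + (k1 + k3) * p - 2 = ((p : ℤ) ^ 2 - 1) * u := by
    rw [hu]; linear_combination ht
  have hub : ((k1 : ℤ) + k3) * p ≤ (2 * p - 2) * p :=
    mul_le_mul_of_nonneg_right (by omega) (by omega)
  have hlb : 0 ≤ ((k1 : ℤ) + k3) * p := by positivity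
  have u0 : 0 ≤ u := by
    by_contra hneg
    have : u ≤ -1 := by omega
    have : ((p : ℤ) ^ 2 - 1) * u ≤ ((p : ℤ) ^ 2 - 1) * (-1) :=
      mul_le_mul_of_nonneg_left this (by omega)
    omega
  have u1 : u ≤ 1 := by
    by_contra hneg
    have : 2 ≤ u := by omega
    have : ((p : ℤ) ^ 2 - 1) * 2 ≤ ((p : ℤ) ^ 2 - 1) * u :=
      mul_le_mul_of_nonneg_left this (by omega)
    have : (k0 : ℤ) + k2 ≤ 2 * p - 2 := by omega
    nlinarith
  have : u = 0 ∨ u = 1 := by omega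
  rcases this with rfl | rfl
  · have hz : k1 + k3 = 0 := by
      by_contra hne
      have h1 : (1 : ℤ) * p ≤ ((k1 : ℤ) + k3) * p :=
        mul_le_mul_of_nonneg_right (by omega) (by omega)
      omega
    have e1 : k1 = 0 := by omega
    have e3 : k3 = 0 := by omega
    subst e1 e3
    have h02 : k0 + k2 = 2 := by push_cast at hu2; omega
    have : k2 = 0 ∨ k2 = 1 ∨ k2 = 2 := by omega
    rcases this with rfl | rfl | rfl
    · left
      have : K = 2 := by omega
      rwa [this] at hK
    · exfalso
      have hK' : K = p ^ 2 + 1 := by omega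
      have hd : p ^ 2 + 1 ∣ p ^ 4 - 1 := by rw [hp42]; exact dvd_mul_left _ _
      apply hpl.gcd h2 (p ^ 2 + 1) (by omega) _ (by rw [hF]; exact hd)
      rw [hK.dvd_iff hd, hK']
    · right
      have : K = 2 * p ^ 2 := by omega
      rwa [this] at hK
  · exfalso
    have hs : (k0 : ℤ) + k2 - 1 = p * (p - k1 - k3) := by linear_combination hu2
    obtain ⟨s, hsd⟩ : ∃ s : ℤ, s = p - k1 - k3 := ⟨_, rfl⟩
    rw [← hsd] at hs
    have s0 : 0 ≤ s := by
      by_contra hneg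
      have : (p : ℤ) * s ≤ p * (-1) := mul_le_mul_of_nonneg_left (by omega) (by omega)
      omega
    have s1 : s ≤ 1 := by
      by_contra hneg
      have : (p : ℤ) * 2 ≤ p * s := mul_le_mul_of_nonneg_left (by omega) (by omega)
      omega
    have : s = 0 ∨ s = 1 := by omega
    rcases this with rfl | rfl
    · have h13 : k1 + k3 = p := by omega
      have h02 : k0 = 1 ∧ k2 = 0 ∨ k0 = 0 ∧ k2 = 1 := by omega
      rcases h02 with ⟨rfl, rfl⟩ | ⟨rfl, rfl⟩
      · refine pm_exceptional p k k1 k3 hp5 hk hF hpl h13 l1 l3 ?_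
        rw [hKd] at hK
        simpa using hK
      · refine pm_exceptional p (k * p * p) k3 k1 hp5 (by positivity) hF ((hpl.frob p).frob p)
          (by omega) l3 l1 ?_
        have h1 : k * p * p ≡ K * p * p [MOD p ^ 4 - 1] := (hK.mul_right _).mul_right _
        refine h1.trans ?_
        rw [hKd]
        refine ((Nat.modEq_iff_dvd).2 ⟨-(1 + k3 * p), ?_⟩)
        rw [Nat.cast_sub hp4.le]
        push_cast
        ring
    · obtain ⟨e0, he0⟩ : ∃ e, e + k0 + 1 = p := ⟨p - 1 - k0, by omega⟩
      obtain ⟨e1, he1⟩ : ∃ e, e + k1 + 1 = p := ⟨p - 1 - k1, by omega⟩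
      obtain ⟨e2, he2⟩ : ∃ e, e + k2 + 1 = p := ⟨p - 1 - k2, by omega⟩
      obtain ⟨e3, he3⟩ : ∃ e, e + k3 + 1 = p := ⟨p - 1 - k3, by omega⟩
      refine pm_d4 p k K hk hF hpl hK e0 e1 e2 e3 1 0 0 (by omega) (by omega) 1 ?_
      have z0 : (e0 : ℤ) = p - 1 - k0 := by omega
      have z1 : (e1 : ℤ) = p - 1 - k1 := by omega
      have z2 : (e2 : ℤ) = p - 1 - k2 := by omega
      have z3 : (e3 : ℤ) = p - 1 - k3 := by omega
      rw [hKd]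
      push_cast
      rw [z0, z1, z2, z3]
      ring

lemma pm_forward (p k : ℕ) [Fact p.Prime] (hp5 : 5 ≤ p) (hk : 0 < k)
    {F : Type*} [Field F] [Fintype F] (hF : Fintype.card F = p ^ 4) (hpl : PMPlanar F k) :
    ∃ j < 4, k ≡ 2 * p ^ j [MOD p ^ 4 - 1] := by
  have hp : p.Prime := Fact.out
  have hch : CharP F p := charP_of_card_eq_prime_pow hF
  letI : Algebra (ZMod p) F := ZMod.algebra F p
  have h2 : (2 : F) ≠ 0 := by
    intro h
    have h' : ((2 : ℕ) : F) = 0 := by exact_mod_cast h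
    have := Nat.le_of_dvd (by norm_num) ((CharP.cast_eq_zero_iff F p 2).1 h')
    omega
  have hp42 : p ^ 4 - 1 = (p ^ 2 - 1) * (p ^ 2 + 1) := by
    zify [Nat.one_le_pow 4 p (by omega), Nat.one_le_pow 2 p (by omega)]; ring
  have hp21 : p ^ 2 - 1 = (p + 1) * (p - 1) := by
    zify [Nat.one_le_pow 2 p (by omega), hp.one_le]; ring
  have hp4 : 1 < p ^ 4 := Nat.one_lt_pow (by norm_num) (by omega)
  have hp2 : 1 < p ^ 2 := Nat.one_lt_pow (by norm_num) (by omega)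
  have hfr : Module.finrank (ZMod p) F = 4 := by
    have := FiniteField.pow_finrank_eq_card p F
    rw [hF] at this
    exact Nat.pow_right_injective hp.two_le this
  have hfr2 : Module.finrank (ZMod p) (GaloisField p 2) = 2 := GaloisField.finrank p (by norm_num)
  obtain ⟨φ⟩ := FiniteField.nonempty_algHom_of_finrank_dvd (F := ZMod p) (K := GaloisField p 2)
    (L := F) (by rw [hfr, hfr2]; norm_num)
  letI : Fintype (GaloisField p 2) := Fintype.ofFinite _
  have hc2 : Fintype.card (GaloisField p 2) = p ^ 2 := by
    rw [← Nat.card_eq_fintype_card, GaloisField.card p 2 (by norm_num)]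
  rcases pm_square_field p k hp5 hk hc2 (hpl.sub φ.toRingHom) with h | h | h
  · rcases pm_main_aux p k hp5 hk hF h2 hpl h with h | h
    · exact ⟨0, by norm_num, by simpa using h⟩
    · exact ⟨2, by norm_num, h⟩
  · have hkp : k * p ≡ 2 [MOD p ^ 2 - 1] := by
      refine (h.mul_right p).trans ((Nat.modEq_iff_dvd).2 ⟨-2, ?_⟩)
      rw [Nat.cast_sub hp2.le]
      push_cast
      ring
    have hback : ∀ m, k * p ≡ m [MOD p ^ 4 - 1] → k ≡ m * p ^ 3 [MOD p ^ 4 - 1] := by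
      intro m hm
      refine Nat.ModEq.trans ?_ (hm.mul_right (p ^ 3))
      refine (Nat.modEq_iff_dvd).2 ⟨k, ?_⟩
      rw [Nat.cast_sub hp4.le]
      push_cast
      ring
    rcases pm_main_aux p (k * p) hp5 (by positivity) hF h2 (hpl.frob p) hkp with h | h
    · exact ⟨3, by norm_num, hback _ h⟩
    · refine ⟨1, by norm_num, (hback _ h).trans ((Nat.modEq_iff_dvd).2 ⟨-(2 * p), ?_⟩)⟩
      rw [Nat.cast_sub hp4.le]
      push_cast
      ring
  · exfalso
    have hd2 : p + 1 ∣ p ^ 2 - 1 := by rw [hp21]; exact dvd_mul_right _ _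
    have hd : p + 1 ∣ p ^ 4 - 1 := hd2.trans (by rw [hp42]; exact dvd_mul_right _ _)
    apply hpl.gcd h2 (p + 1) (by omega) _ (by rw [hF]; exact hd)
    rw [h.dvd_iff hd2]

lemma pm_backward (p k j : ℕ) [Fact p.Prime] (hp5 : 5 ≤ p) (hk : 0 < k)
    {F : Type*} [Field F] [Fintype F] (hF : Fintype.card F = p ^ 4)
    (h : k ≡ 2 * p ^ j [MOD p ^ 4 - 1]) : PMPlanar F k := by
  have hp : p.Prime := Fact.out
  have hch : CharP F p := charP_of_card_eq_prime_pow hF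
  have h2 : (2 : F) ≠ 0 := by
    intro h
    have h' : ((2 : ℕ) : F) = 0 := by exact_mod_cast h
    have := Nat.le_of_dvd (by norm_num) ((CharP.cast_eq_zero_iff F p 2).1 h')
    omega
  have hpow : ∀ x : F, x ^ k = (x ^ 2) ^ p ^ j := by
    intro x
    rw [← pow_mul]
    by_cases hx : x = 0
    · rw [hx, zero_pow hk.ne', zero_pow (by positivity)]
    · have h1 : x ^ (p ^ 4 - 1) = 1 := by rw [← hF]; exact FiniteField.pow_card_sub_one_eq_one x hx
      rw [pow_eq_pow_mod k h1, pow_eq_pow_mod (2 * p ^ j) h1, h]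
  intro a ha x y hxy
  simp only [hpow, ← sub_pow_char_pow] at hxy
  have := iterateFrobenius_inj F p j (by simpa [iterateFrobenius_def] using hxy)
  have h3 : 2 * a * (x - y) = 0 := by linear_combination this
  have h4 : x - y = 0 := by
    rcases mul_eq_zero.1 h3 with h | h
    · exact absurd h (mul_ne_zero h2 ha)
    · exact h
  exact sub_eq_zero.1 h4

theorem stmt_12 (p : ℕ) (hp : p.Prime) (hp5 : 5 ≤ p) (k : ℕ) (hk : 0 < k)
    (F : Type*) [Field F] [Fintype F] (hF : Fintype.card F = p ^ 4) :
    (∀ a : F, a ≠ 0 → Function.Bijective (fun x : F => (x + a) ^ k - x ^ k)) ↔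
      ∃ j < 4, k ≡ 2 * p ^ j [MOD p ^ 4 - 1] := by
  have : Fact p.Prime := ⟨hp⟩
  constructor
  · intro h
    exact pm_forward p k hp5 hk hF (fun a ha => (h a ha).injective)
  · rintro ⟨j, _, h⟩
    exact (pm_backward p k j hp5 hk hF h).bij
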